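/- Fix reals a < b and x ∈ ℝ, and let G : ℕ → (0,∞) be a decreasing sequence with G(0) = 1 and lim_{n→∞} G(n) = 0. Then P_x-a.s., M_t^{↓,G} > 0 for every t ≥ 0. -/

import Mathlib

open MeasureTheory ProbabilityTheory Filter
open scoped NNReal ENNReal Topology

noncomputable section

/-- The natural filtration `F_t = σ(X_s : s ≤ t)` of a real-valued process indexed by `ℝ≥0`. -/
def natFiltration {Ω : Type*} [m : MeasurableSpace Ω] (X : ℝ≥0 → Ω → ℝ) :
    MeasureTheory.Filtration ℝ≥0 m where
  seq t := (⨆ s ∈ Set.Iic t, MeasurableSpace.comap (X s) Real.measurableSpace) ⊓ m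
  mono' := fun s t hst =>
    inf_le_inf_right m (biSup_mono fun u (hu : u ∈ Set.Iic s) => le_trans hu hst)
  le' := fun _ => inf_le_right

/-- The running supremum `S_t = sup_{0 ≤ u ≤ t} X_u` of a process indexed by `ℝ≥0`. -/
def runSup {Ω : Type*} (X : ℝ≥0 → Ω → ℝ) (t : ℝ≥0) (ω : Ω) : ℝ :=
  sSup ((fun u => X u ω) '' Set.Iic t)

/-- A real-valued process `X` indexed by `ℝ≥0` is a standard one-dimensional Brownian
motion started at `x` under `P`. -/
structure IsBrownianMotion {Ω : Type*} [m : MeasurableSpace Ω] (P : Measure Ω)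
    (X : ℝ≥0 → Ω → ℝ) (x : ℝ) : Prop where
  stronglyMeasurable : ∀ t, StronglyMeasurable (X t)
  init : ∀ᵐ ω ∂P, X 0 ω = x
  cont : ∀ᵐ ω ∂P, Continuous fun t => X t ω
  gauss_incr : ∀ s t : ℝ≥0, s ≤ t →
    P.map (fun ω => X t ω - X s ω) = gaussianReal 0 (t - s)
  indep_incr : ∀ s t : ℝ≥0, s ≤ t →
    Indep (MeasurableSpace.comap (fun ω => X t ω - X s ω) Real.measurableSpace)
      (natFiltration X s) P

open scoped Classical in
/-- The alternating sequence of stopping times of up-crossings of `b` and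
down-crossings of `a`: `σ_0 = 0`, `σ_{2n+1} = inf{t ≥ σ_{2n} : X_t > b}`,
`σ_{2n+2} = inf{t ≥ σ_{2n+1} : X_t < a}` (with `inf ∅ = ∞`). -/
noncomputable def dcSigma {Ω : Type*} (a b : ℝ) (X : ℝ≥0 → Ω → ℝ) (ω : Ω) : ℕ → ℝ≥0∞
  | 0 => 0
  | Nat.succ n =>
      sInf ((fun u : ℝ≥0 => (u : ℝ≥0∞)) ''
        {u : ℝ≥0 | dcSigma a b X ω n ≤ (u : ℝ≥0∞) ∧
          (if Even n then b < X u ω else X u ω < a)})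

/-- `D_t`, the number of down-crossings from `b` to `a` before time `t`:
the number of indices `n ≥ 1` with `σ_{2n} ≤ t`. -/
noncomputable def dcD {Ω : Type*} (a b : ℝ) (X : ℝ≥0 → Ω → ℝ) (t : ℝ≥0) (ω : Ω) : ℕ :=
  Set.ncard {n : ℕ | 1 ≤ n ∧ dcSigma a b X ω (2 * n) ≤ (t : ℝ≥0∞)}

open scoped Classical in
/-- The down-crossing martingale `M_t^{↓,G}`. -/
noncomputable def dcM {Ω : Type*} (a b : ℝ) (G : ℕ → ℝ) (X : ℝ≥0 → Ω → ℝ)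
    (t : ℝ≥0) (ω : Ω) : ℝ :=
  ∑' n : ℕ,
    ((if dcSigma a b X ω (2 * n) ≤ (t : ℝ≥0∞) ∧ (t : ℝ≥0∞) < dcSigma a b X ω (2 * n + 1)
        then G n / 2 * (1 + (b - X t ω) / (b - a)) + G (n + 1) / 2 * ((X t ω - a) / (b - a))
        else 0)
      + (if dcSigma a b X ω (2 * n + 1) ≤ (t : ℝ≥0∞) ∧
            (t : ℝ≥0∞) < dcSigma a b X ω (2 * n + 2)
        then G (n + 1) / 2 * (1 + (b - X t ω) / (b - a)) + G n / 2 * ((X t ω - a) / (b - a))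
        else 0))

theorem dcSigma_monotone {Ω : Type*} (a b : ℝ) (X : ℝ≥0 → Ω → ℝ) (ω : Ω) :
    Monotone (dcSigma a b X ω) := by
  refine monotone_nat_of_le_succ fun n => ?_
  rw [dcSigma]
  refine le_sInf ?_
  rintro _ ⟨u, hu, rfl⟩
  exact hu.1

/-- If `σ_k ≤ t < σ_{k+1}`, then `t` is not in the set whose infimum is `σ_{k+1}`. -/
theorem not_crossed_of_lt_dcSigma_succ {Ω : Type*} {a b : ℝ} {X : ℝ≥0 → Ω → ℝ} {ω : Ω}
    {k : ℕ} {t : ℝ≥0} (h₁ : dcSigma a b X ω k ≤ t) (h₂ : (t : ℝ≥0∞) < dcSigma a b X ω (k + 1)) :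
    ¬ (if Even k then b < X t ω else X t ω < a) := by
  intro h
  rw [dcSigma] at h₂
  exact h₂.not_ge (sInf_le ⟨t, ⟨h₁, h⟩, rfl⟩)

/-- Along a continuous path the crossing times are unbounded. -/
theorem exists_lt_dcSigma {Ω : Type*} {a b : ℝ} (hab : a < b) {X : ℝ≥0 → Ω → ℝ} {ω : Ω}
    (hc : Continuous fun t => X t ω) (t : ℝ≥0) : ∃ k, (t : ℝ≥0∞) < dcSigma a b X ω k := by
  by_contra! hle
  have hfin : ∀ k, dcSigma a b X ω k ≠ ∞ := fun k => ((hle k).trans_lt ENNReal.coe_lt_top).ne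
  have hlim := tendsto_atTop_iSup (dcSigma_monotone a b X ω)
  have hL : ⨆ k, dcSigma a b X ω k ≠ ∞ := ((iSup_le hle).trans_lt ENNReal.coe_lt_top).ne
  generalize ⨆ k, dcSigma a b X ω k = L at hlim hL
  have hu : ∀ k : ℕ, ∃ u : ℝ≥0, dcSigma a b X ω k ≤ u ∧
      (u : ℝ≥0∞) ≤ dcSigma a b X ω (k + 1) + (k : ℝ≥0∞)⁻¹ ∧
      (if Even k then b < X u ω else X u ω < a) := by
    intro k
    have hlt : dcSigma a b X ω (k + 1) < dcSigma a b X ω (k + 1) + (k : ℝ≥0∞)⁻¹ :=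
      ENNReal.lt_add_right (hfin _) (by simp)
    conv_lhs at hlt => rw [dcSigma]
    obtain ⟨_, ⟨u, hu, rfl⟩, hlt⟩ := sInf_lt_iff.1 hlt
    exact ⟨u, hu.1, hlt.le, hu.2⟩
  choose u hu₁ hu₂ hu₃ using hu
  have hu_lim : Tendsto (fun k => (u k : ℝ≥0∞)) atTop (𝓝 L) := by
    refine tendsto_of_tendsto_of_tendsto_of_le_of_le hlim ?_ hu₁ hu₂
    simpa using ((tendsto_add_atTop_iff_nat 1).2 hlim).add ENNReal.tendsto_inv_nat_nhds_zero
  lift L to ℝ≥0 using hL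
  have hX : Tendsto (fun k => X (u k) ω) atTop (𝓝 (X L ω)) :=
    (hc.tendsto L).comp (ENNReal.tendsto_coe.1 hu_lim)
  have heven : Tendsto (fun n : ℕ => 2 * n) atTop atTop :=
    tendsto_atTop_mono (fun n => by dsimp only [id]; omega) tendsto_id
  have hodd : Tendsto (fun n : ℕ => 2 * n + 1) atTop atTop :=
    tendsto_atTop_mono (fun n => by dsimp only [id]; omega) tendsto_id
  have hb : b ≤ X L ω := ge_of_tendsto' (hX.comp heven) fun n => by
    have := hu₃ (2 * n)
    rw [if_pos (even_two_mul n)] at this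
    exact this.le
  have ha : X L ω ≤ a := le_of_tendsto' (hX.comp hodd) fun n => by
    have := hu₃ (2 * n + 1)
    rw [if_neg (by simp)] at this
    exact this.le
  linarith

theorem exists_dcSigma_le_and_lt {Ω : Type*} {a b : ℝ} (hab : a < b) {X : ℝ≥0 → Ω → ℝ} {ω : Ω}
    (hc : Continuous fun t => X t ω) (t : ℝ≥0) :
    ∃ k, dcSigma a b X ω k ≤ t ∧ (t : ℝ≥0∞) < dcSigma a b X ω (k + 1) := by
  classical
  have hex := exists_lt_dcSigma hab hc t
  obtain ⟨k, hk⟩ : ∃ k, Nat.find hex = k + 1 := by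
    refine Nat.exists_eq_succ_of_ne_zero fun h0 => ?_
    have := Nat.find_spec hex
    simp [h0, dcSigma] at this
  refine ⟨k, not_lt.1 (Nat.find_min hex (by omega)), ?_⟩
  rw [← hk]
  exact Nat.find_spec hex

theorem half_interpolation_pos {p q y : ℝ} (hq : 0 < q) (hqp : q ≤ p) (hy : y ≤ 1) :
    0 < p / 2 * (1 + (1 - y)) + q / 2 * y := by
  rcases le_total 0 y with h | h <;> nlinarith

theorem dcM_pos {Ω : Type*} {a b : ℝ} (hab : a < b) {G : ℕ → ℝ} (hGpos : ∀ n, 0 < G n)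
    (hGanti : Antitone G) {X : ℝ≥0 → Ω → ℝ} {ω : Ω} (hc : Continuous fun t => X t ω) (t : ℝ≥0) :
    0 < dcM a b G X t ω := by
  obtain ⟨k, hk₁, hk₂⟩ := exists_dcSigma_le_and_lt hab hc t
  have hcross := not_crossed_of_lt_dcSigma_succ hk₁ hk₂
  have huniq : ∀ j, dcSigma a b X ω j ≤ t → (t : ℝ≥0∞) < dcSigma a b X ω (j + 1) → j = k := by
    intro j hj₁ hj₂
    have h₁ := (dcSigma_monotone a b X ω).reflect_lt (hk₁.trans_lt hj₂)
    have h₂ := (dcSigma_monotone a b X ω).reflect_lt (hj₁.trans_lt hk₂)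
    omega
  have hba : 0 < b - a := sub_pos.2 hab
  have hyb : (b - X t ω) / (b - a) = 1 - (X t ω - a) / (b - a) := by field_simp; ring
  unfold dcM
  rcases Nat.even_or_odd' k with ⟨n, rfl | rfl⟩
  · rw [tsum_eq_single n]
    · rw [if_pos ⟨hk₁, hk₂⟩, if_neg fun h => by have := huniq _ h.1 h.2; omega, add_zero, hyb]
      refine half_interpolation_pos (hGpos _) (hGanti n.le_succ) ?_
      rw [if_pos (even_two_mul n), not_lt] at hcross
      rw [div_le_one hba]
      linarith
    · intro j hj
      rw [if_neg fun h => by have := huniq _ h.1 h.2; omega,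
        if_neg fun h => by have := huniq _ h.1 h.2; omega, add_zero]
  · rw [tsum_eq_single n]
    · rw [if_neg fun h => by have := huniq _ h.1 h.2; omega, if_pos ⟨hk₁, hk₂⟩, zero_add, hyb]
      rw [if_neg (by simp), not_lt] at hcross
      have hy : 0 ≤ (X t ω - a) / (b - a) := div_nonneg (by linarith) hba.le
      nlinarith [hGpos (n + 1), mul_nonneg hy (sub_nonneg.2 (hGanti n.le_succ))]
    · intro j hj
      rw [if_neg fun h => by have := huniq _ h.1 h.2; omega,
        if_neg fun h => by have := huniq _ h.1 h.2; omega, add_zero]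

/-- If `G` is a decreasing sequence of positive numbers with `G(0) = 1` and
`G(n) → 0`, then `P_x`-a.s. `M_t^{↓,G} > 0` for all `t`. -/
theorem downcrossing_martingale_pos
    {Ω : Type*} [m : MeasurableSpace Ω] (P : Measure Ω) [IsProbabilityMeasure P]
    (a b : ℝ) (hab : a < b) (x : ℝ)
    (X : ℝ≥0 → Ω → ℝ) (hX : IsBrownianMotion P X x)
    (G : ℕ → ℝ) (hGpos : ∀ n, 0 < G n) (hGanti : Antitone G)
    (hG0 : G 0 = 1) (hGlim : Filter.Tendsto G Filter.atTop (nhds 0)) :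
    ∀ᵐ ω ∂P, ∀ t : ℝ≥0, 0 < dcM a b G X t ω := by
  filter_upwards [hX.cont] with ω hc t
  exact dcM_pos hab hGpos hGanti hc t

end
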